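/- arXiv:2310.11387 — 2 statements merged into one kernel-verified Lean document; each statement's English description precedes it below -/
import Mathlib

section
/- Let τ_y be a type 1 toggle in T(𝓛). If τ_y(𝓑) = 𝓑 for some block 𝓑 of the fixed block system, then τ_y fixes every element of 𝓑 (i.e., τ_y(A) = A for all A ∈ 𝓑). -/
open scoped symmDiff

namespace TogglePaper

variable {E : Type*} [DecidableEq E]

/-- The toggle `τ_e` on the collection `L` of subsets of the ground set. -/
def toggle (L : Finset (Finset E)) (e : E) : Equiv.Perm {A : Finset E // A ∈ L} :=
  Function.Involutive.toPerm
    (fun X => if h : X.1 ∆ ({e} : Finset E) ∈ L then ⟨X.1 ∆ ({e} : Finset E), h⟩ else X)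
    (by
      intro X
      by_cases h : X.1 ∆ ({e} : Finset E) ∈ L
      · have h2 : (X.1 ∆ ({e} : Finset E)) ∆ ({e} : Finset E) = X.1 :=
          symmDiff_symmDiff_cancel_right _ _
        simp only [dif_pos h, h2]
        simp [h2, X.2]
      · simp [h])

/-- The generalized toggle group `T(L)`. -/
def toggleGroup (L : Finset (Finset E)) : Subgroup (Equiv.Perm {A : Finset E // A ∈ L}) :=
  Subgroup.closure (Set.range (toggle L))

/-- `T(L)` acts transitively on `L`. -/
def IsTransitive (L : Finset (Finset E)) : Prop :=
  ∀ A B : {A : Finset E // A ∈ L}, ∃ g ∈ toggleGroup L, g A = B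

/-- `B` is a block for the action of `T(L)` on `L`. -/
def IsBlock (L : Finset (Finset E)) (B : Finset {A : Finset E // A ∈ L}) : Prop :=
  ∀ g ∈ toggleGroup L, Finset.image g B = B ∨ Disjoint (Finset.image g B) B

/-- `Blocks` is a block system for `T(L)`: a partition of `L` into nonempty blocks
that is permuted by every element of `T(L)`. -/
def IsBlockSystem (L : Finset (Finset E))
    (Blocks : Finset (Finset {A : Finset E // A ∈ L})) : Prop :=
  (∀ B ∈ Blocks, B.Nonempty) ∧
  (∀ A : {A : Finset E // A ∈ L}, ∃! B : Finset {A : Finset E // A ∈ L},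
      B ∈ Blocks ∧ A ∈ B) ∧
  (∀ g ∈ toggleGroup L, ∀ B ∈ Blocks, Finset.image g B ∈ Blocks)

/-- An element `g` of `T(L)` is type 2 (with respect to a fixed block system `Blocks`)
if it maps each block to itself; it is type 1 otherwise. -/
def IsType2 (L : Finset (Finset E)) (Blocks : Finset (Finset {A : Finset E // A ∈ L}))
    (g : Equiv.Perm {A : Finset E // A ∈ L}) : Prop :=
  ∀ B ∈ Blocks, Finset.image g B = B

/-- The action of `T(L)` on `L` is primitive: it is transitive and the only blocks
are the singletons, the empty set and the whole set. -/
def IsPrimitive (L : Finset (Finset E)) : Prop :=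
  IsTransitive L ∧
    ∀ B : Finset {A : Finset E // A ∈ L}, IsBlock L B → B.card ≤ 1 ∨ B = Finset.univ

/-- `T(L)` contains a long cycle, i.e. a cycle whose support is all of `L`. -/
def HasLongCycle (L : Finset (Finset E)) : Prop :=
  ∃ g ∈ toggleGroup L, g.IsCycle ∧ g.support = Finset.univ

theorem toggle_apply (L : Finset (Finset E)) (e : E) (X : {A : Finset E // A ∈ L}) :
    toggle L e X = if h : X.1 ∆ ({e} : Finset E) ∈ L then ⟨X.1 ∆ ({e} : Finset E), h⟩ else X :=
  rfl

theorem toggle_toggle (L : Finset (Finset E)) (e : E) (X : {A : Finset E // A ∈ L}) :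
    toggle L e (toggle L e X) = X :=
  Function.Involutive.toPerm_involutive _ X

theorem inv_toggle (L : Finset (Finset E)) (e : E) : (toggle L e)⁻¹ = toggle L e := by
  ext1 X
  rw [Equiv.Perm.inv_eq_iff_eq, toggle_toggle]

theorem toggle_mem_toggleGroup (L : Finset (Finset E)) (e : E) : toggle L e ∈ toggleGroup L :=
  Subgroup.subset_closure ⟨e, rfl⟩

theorem toggle_val_of_ne {L : Finset (Finset E)} {e : E} {X : {A : Finset E // A ∈ L}}
    (h : toggle L e X ≠ X) : (toggle L e X).1 = X.1 ∆ {e} := by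
  by_cases hX : X.1 ∆ {e} ∈ L
  · simp [toggle_apply, hX]
  · exact absurd (by simp [toggle_apply, hX]) h

theorem toggle_eq_of_val_eq {L : Finset (Finset E)} {e : E} {X Z : {A : Finset E // A ∈ L}}
    (h : Z.1 = X.1 ∆ {e}) : toggle L e X = Z := by
  have hX : X.1 ∆ {e} ∈ L := h ▸ Z.2
  rw [toggle_apply, dif_pos hX]
  exact Subtype.ext h.symm

/-- `B` contains two sets that differ exactly in the element `y`. -/
def HasEdge (L : Finset (Finset E)) (y : E) (B : Finset {A : Finset E // A ∈ L}) : Prop :=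
  ∃ X ∈ B, ∃ Z ∈ B, Z.1 = X.1 ∆ {y}

theorem IsBlockSystem.eq_of_mem {L : Finset (Finset E)}
    {Blocks : Finset (Finset {A : Finset E // A ∈ L})} (hBS : IsBlockSystem L Blocks)
    {B C : Finset {A : Finset E // A ∈ L}} (hB : B ∈ Blocks) (hC : C ∈ Blocks)
    {A : {A : Finset E // A ∈ L}} (hAB : A ∈ B) (hAC : A ∈ C) : B = C :=
  (hBS.2.1 A).unique ⟨hB, hAB⟩ ⟨hC, hAC⟩

theorem HasEdge.image_toggle {L : Finset (Finset E)}
    {Blocks : Finset (Finset {A : Finset E // A ∈ L})} (hBS : IsBlockSystem L Blocks)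
    {y : E} {B : Finset {A : Finset E // A ∈ L}} (hB : B ∈ Blocks) (h : HasEdge L y B) (x : E) :
    HasEdge L y (Finset.image (toggle L x) B) := by
  by_cases hx : Finset.image (toggle L x) B = B
  · rwa [hx]
  have hmoved : ∀ X ∈ B, toggle L x X ≠ X := fun X hX hfix =>
    hx (hBS.eq_of_mem (hBS.2.2 _ (toggle_mem_toggleGroup L x) B hB) hB
      (Finset.mem_image.2 ⟨X, hX, hfix⟩) hX)
  obtain ⟨X, hX, Z, hZ, hXZ⟩ := h
  refine ⟨_, Finset.mem_image_of_mem _ hX, _, Finset.mem_image_of_mem _ hZ, ?_⟩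
  rw [toggle_val_of_ne (hmoved X hX), toggle_val_of_ne (hmoved Z hZ), hXZ, symmDiff_right_comm]

theorem HasEdge.image {L : Finset (Finset E)}
    {Blocks : Finset (Finset {A : Finset E // A ∈ L})} (hBS : IsBlockSystem L Blocks)
    {y : E} {B : Finset {A : Finset E // A ∈ L}} (hB : B ∈ Blocks) (h : HasEdge L y B)
    {g : Equiv.Perm {A : Finset E // A ∈ L}} (hg : g ∈ toggleGroup L) :
    HasEdge L y (Finset.image g B) := by
  have hmul : ∀ (x : E) (k : Equiv.Perm {A : Finset E // A ∈ L}), k ∈ toggleGroup L →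
      HasEdge L y (Finset.image k B) → HasEdge L y (Finset.image (toggle L x * k) B) := by
    intro x k hk hkB
    rw [Equiv.Perm.coe_mul, ← Finset.image_image]
    exact hkB.image_toggle hBS (hBS.2.2 k hk B hB) x
  induction hg using Subgroup.closure_induction_left with
  | one => simpa using h
  | mul_left s hs k hk ih =>
    obtain ⟨x, rfl⟩ := hs
    exact hmul x k hk ih
  | inv_mul_cancel s hs k hk ih =>
    obtain ⟨x, rfl⟩ := hs
    rw [inv_toggle]
    exact hmul x k hk ih

/-- If a type 1 toggle maps a block to itself, it fixes the block pointwise. -/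
theorem type1_toggle_fixing_block_is_identity_on_block
    [Fintype E] (L : Finset (Finset E))
    (hnt : ∀ e : E, toggle L e ≠ 1)
    (htrans : IsTransitive L)
    (Blocks : Finset (Finset {A : Finset E // A ∈ L}))
    (hBS : IsBlockSystem L Blocks)
    (y : E) (hy : ¬ IsType2 L Blocks (toggle L y))
    (B : Finset {A : Finset E // A ∈ L}) (hB : B ∈ Blocks)
    (hfix : Finset.image (toggle L y) B = B) :
    ∀ A ∈ B, toggle L y A = A := by
  intro A hA
  by_contra hne
  have hedge : HasEdge L y B :=
    ⟨A, hA, _, hfix ▸ Finset.mem_image_of_mem _ hA, toggle_val_of_ne hne⟩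
  refine hy fun C hC => ?_
  obtain ⟨D, hD⟩ := hBS.1 C hC
  obtain ⟨g, hg, hgA⟩ := htrans A D
  have hgB : Finset.image g B = C :=
    hBS.eq_of_mem (hBS.2.2 g hg B hB) hC (Finset.mem_image.2 ⟨A, hA, hgA⟩) hD
  obtain ⟨X, hX, Z, hZ, hXZ⟩ := hgB ▸ hedge.image hBS hB hg
  exact hBS.eq_of_mem (hBS.2.2 _ (toggle_mem_toggleGroup L y) C hC) hC
    (Finset.mem_image.2 ⟨X, hX, toggle_eq_of_val_eq hXZ⟩) hZ

end TogglePaper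
end

section
/- Let σ ∈ T(𝓛) be a product of type 1 toggles. Then for each block 𝓑 of the fixed block system there exists a set X ⊆ E such that σ(A) = A △ X for every A ∈ 𝓑. In particular, if σ(𝓑) = 𝓑 then the restriction of σ to 𝓑 is either the identity on 𝓑 or an involution of 𝓑 with no fixed points. -/
open scoped symmDiff

namespace TogglePaper

variable {E : Type*} [DecidableEq E]

theorem toggle_apply_val_of_ne {L : Finset (Finset E)} {e : E} {A : {A : Finset E // A ∈ L}}
    (h : toggle L e A ≠ A) : (toggle L e A).1 = A.1 ∆ {e} := by
  by_cases hA : A.1 ∆ ({e} : Finset E) ∈ L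
  · exact congrArg Subtype.val (dif_pos hA)
  · exact absurd (dif_neg hA) h

/-- A toggle that moves a block acts on it by symmetric difference. -/
theorem IsBlockSystem.toggle_apply_val {L : Finset (Finset E)}
    {Blocks : Finset (Finset {A : Finset E // A ∈ L})} (hBS : IsBlockSystem L Blocks)
    {e : E} {B : Finset {A : Finset E // A ∈ L}} (hB : B ∈ Blocks)
    (hne : Finset.image (toggle L e) B ≠ B) {A : {A : Finset E // A ∈ L}} (hA : A ∈ B) :
    (toggle L e A).1 = A.1 ∆ {e} := by
  refine toggle_apply_val_of_ne fun h => hne ?_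
  refine hBS.eq_of_mem (hBS.2.2 _ (toggle_mem_toggleGroup L e) B hB) hB (A := A) ?_ hA
  exact Finset.mem_image.2 ⟨A, hA, h⟩

theorem IsBlockSystem.mem_image_toggle_iff {L : Finset (Finset E)}
    {Blocks : Finset (Finset {A : Finset E // A ∈ L})} (hBS : IsBlockSystem L Blocks)
    {e : E} {B : Finset {A : Finset E // A ∈ L}} (hB : B ∈ Blocks)
    (hne : Finset.image (toggle L e) B ≠ B) (S : Finset E) :
    S ∈ (B.image (toggle L e)).image Subtype.val ↔ S ∆ {e} ∈ B.image Subtype.val := by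
  constructor
  · intro h
    obtain ⟨_, hC, rfl⟩ := Finset.mem_image.1 h
    obtain ⟨A, hA, rfl⟩ := Finset.mem_image.1 hC
    rw [hBS.toggle_apply_val hB hne hA, symmDiff_symmDiff_cancel_right]
    exact Finset.mem_image_of_mem _ hA
  · intro h
    obtain ⟨A, hA, hAS⟩ := Finset.mem_image.1 h
    have hS : (toggle L e A).1 = S := by
      rw [hBS.toggle_apply_val hB hne hA, hAS, symmDiff_symmDiff_cancel_right]
    rw [← hS]
    exact Finset.mem_image_of_mem _ (Finset.mem_image_of_mem _ hA)

/-- The image of a block under an element of the toggle group is a translate of the block. -/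
theorem IsBlockSystem.exists_translate {L : Finset (Finset E)}
    {Blocks : Finset (Finset {A : Finset E // A ∈ L})} (hBS : IsBlockSystem L Blocks)
    {g : Equiv.Perm {A : Finset E // A ∈ L}} (hg : g ∈ toggleGroup L) :
    ∀ B ∈ Blocks, ∃ X : Finset E, ∀ S : Finset E,
      S ∈ (B.image g).image Subtype.val ↔ S ∆ X ∈ B.image Subtype.val := by
  induction hg using Subgroup.closure_induction with
  | mem g hg =>
    obtain ⟨e, rfl⟩ := hg
    intro B hB
    by_cases hne : Finset.image (toggle L e) B = B
    · refine ⟨⊥, fun S => ?_⟩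
      rw [hne, symmDiff_bot]
    · exact ⟨{e}, hBS.mem_image_toggle_iff hB hne⟩
  | one =>
    refine fun B _ => ⟨⊥, fun S => ?_⟩
    rw [symmDiff_bot, Equiv.Perm.coe_one, Finset.image_id]
  | mul g h hg hh ihg ihh =>
    intro B hB
    obtain ⟨X, hX⟩ := ihh B hB
    obtain ⟨Y, hY⟩ := ihg _ (hBS.2.2 h hh B hB)
    refine ⟨Y ∆ X, fun S => ?_⟩
    rw [Equiv.Perm.coe_mul, ← Finset.image_image, hY, hX, symmDiff_assoc]
  | inv g hg ih =>
    intro B hB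
    obtain ⟨X, hX⟩ := ih _ (hBS.2.2 g⁻¹ (inv_mem hg) B hB)
    refine ⟨X, fun S => ?_⟩
    have h : (B.image ⇑g⁻¹).image ⇑g = B := by
      rw [Finset.image_image, ← Equiv.Perm.coe_mul, mul_inv_cancel, Equiv.Perm.coe_one,
        Finset.image_id]
    rw [h] at hX
    rw [hX, symmDiff_symmDiff_cancel_right]

/-- A type 1 toggle fixes pointwise every block that it maps to itself. -/
theorem IsBlockSystem.toggle_apply_eq_self {L : Finset (Finset E)}
    {Blocks : Finset (Finset {A : Finset E // A ∈ L})} (hBS : IsBlockSystem L Blocks)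
    (htrans : IsTransitive L) {e : E} (he : ¬ IsType2 L Blocks (toggle L e))
    {B : Finset {A : Finset E // A ∈ L}} (hB : B ∈ Blocks)
    (hfix : Finset.image (toggle L e) B = B) {A : {A : Finset E // A ∈ L}} (hA : A ∈ B) :
    toggle L e A = A := by
  by_contra hmove
  simp only [IsType2, not_forall] at he
  obtain ⟨C, hC, hne⟩ := he
  obtain ⟨D, hD⟩ := hBS.1 C hC
  obtain ⟨g, hg, rfl⟩ := htrans D A
  have hgC : C.image g = B :=
    hBS.eq_of_mem (hBS.2.2 g hg C hC) hB (Finset.mem_image_of_mem _ hD) hA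
  obtain ⟨X, hX⟩ := hBS.exists_translate hg C hC
  rw [hgC] at hX
  have h₁ := (hX _).1 (Finset.mem_image_of_mem _ hA)
  have h₂ := (hX (toggle L e (g D)).1).1
    (Finset.mem_image_of_mem _ (hfix ▸ Finset.mem_image_of_mem _ hA))
  rw [toggle_apply_val_of_ne hmove, symmDiff_right_comm, ← hBS.mem_image_toggle_iff hC hne] at h₂
  obtain ⟨P, hP, hPv⟩ := Finset.mem_image.1 h₁
  obtain ⟨Q, hQ, hQv⟩ := Finset.mem_image.1 h₂
  obtain rfl : P = Q := Subtype.ext (hPv.trans hQv.symm)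
  exact hne (hBS.eq_of_mem (hBS.2.2 _ (toggle_mem_toggleGroup L e) C hC) hC hQ hP)

theorem IsBlockSystem.exists_prod_apply_val {L : Finset (Finset E)}
    {Blocks : Finset (Finset {A : Finset E // A ∈ L})} (hBS : IsBlockSystem L Blocks)
    (htrans : IsTransitive L) (l : List E) (hl : ∀ e ∈ l, ¬ IsType2 L Blocks (toggle L e))
    {B : Finset {A : Finset E // A ∈ L}} (hB : B ∈ Blocks) :
    ∃ X : Finset E, ∀ A ∈ B, ((l.map (toggle L)).prod A).1 = A.1 ∆ X := by
  induction l with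
  | nil => exact ⟨⊥, fun A _ => by rw [symmDiff_bot]; rfl⟩
  | cons e l ih =>
    obtain ⟨X, hX⟩ := ih fun f hf => hl f (List.mem_cons_of_mem _ hf)
    have hg : (l.map (toggle L)).prod ∈ toggleGroup L :=
      Subgroup.list_prod_mem _ fun x hx => by
        obtain ⟨f, -, rfl⟩ := List.mem_map.1 hx
        exact toggle_mem_toggleGroup L f
    have hB' := hBS.2.2 _ hg B hB
    simp only [List.map_cons, List.prod_cons, Equiv.Perm.mul_apply]
    by_cases hfix : Finset.image (toggle L e) (B.image (l.map (toggle L)).prod) =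
        B.image (l.map (toggle L)).prod
    · refine ⟨X, fun A hA => ?_⟩
      rw [hBS.toggle_apply_eq_self htrans (hl e List.mem_cons_self) hB' hfix
        (Finset.mem_image_of_mem _ hA), hX A hA]
    · refine ⟨X ∆ {e}, fun A hA => ?_⟩
      rw [hBS.toggle_apply_val hB' hfix (Finset.mem_image_of_mem _ hA), hX A hA, symmDiff_assoc]

/-- a product of type 1 toggles acts on each block by symmetric
difference with a fixed set; in particular if it maps a block to itself then it is
the identity on the block or a fixed-point-free involution of the block. -/
theorem product_of_type1_toggles_acts_by_symmDiff
    [Fintype E] (L : Finset (Finset E))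
    (hnt : ∀ e : E, toggle L e ≠ 1)
    (htrans : IsTransitive L)
    (Blocks : Finset (Finset {A : Finset E // A ∈ L}))
    (hBS : IsBlockSystem L Blocks)
    (l : List E) (hl : ∀ e ∈ l, ¬ IsType2 L Blocks (toggle L e))
    (B : Finset {A : Finset E // A ∈ L}) (hB : B ∈ Blocks) :
    (∃ X : Finset E, ∀ A ∈ B, ((l.map (toggle L)).prod A).1 = A.1 ∆ X) ∧
    (Finset.image ((l.map (toggle L)).prod) B = B →
      (∀ A ∈ B, (l.map (toggle L)).prod A = A) ∨
      (∀ A ∈ B, (l.map (toggle L)).prod ((l.map (toggle L)).prod A) = A ∧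
        (l.map (toggle L)).prod A ≠ A)) := by
  obtain ⟨X, hX⟩ := hBS.exists_prod_apply_val htrans l hl hB
  refine ⟨⟨X, hX⟩, fun hfix => ?_⟩
  by_cases hX0 : X = ⊥
  · left
    intro A hA
    apply Subtype.ext
    rw [hX A hA, hX0, symmDiff_bot]
  · right
    intro A hA
    have hA' : (l.map (toggle L)).prod A ∈ B := hfix.subset (Finset.mem_image_of_mem _ hA)
    refine ⟨Subtype.ext ?_, fun h => hX0 ?_⟩
    · rw [hX _ hA', hX A hA, symmDiff_symmDiff_cancel_right]
    · have h' := hX A hA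
      rw [h] at h'
      exact symmDiff_eq_left.1 h'.symm

end TogglePaper
end
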